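/- For every natural number m, ∫_{−1}^{1} √(1+z) · T_m(z) dz = 4√2 · (3 − 4m²)/((1 − 4m²)(9 − 4m²)), and ∫_{−1}^{1} √(1−z) · T_m(z) dz = (−1)^m · 4√2 · (3 − 4m²)/((1 − 4m²)(9 − 4m²)). -/

import Mathlib

open Real Polynomial

/-- The integral of `cos (θ / 2) * cos (m * θ) * sin θ` over `[0, π]`. -/
lemma integral_cos_half_mul_cos_mul_sin (m : ℕ) :
    ∫ θ in (0 : ℝ)..π, cos (θ / 2) * cos (m * θ) * sin θ =
      4 * (3 - 4 * (m : ℝ) ^ 2) / ((1 - 4 * (m : ℝ) ^ 2) * (9 - 4 * (m : ℝ) ^ 2)) := by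
  have odd_ne (k l : ℤ) (hk : Odd k) : (k : ℝ) / 2 + l * m ≠ 0 := by
    intro h
    have h' : (k : ℝ) + 2 * (l * m) = 0 := by linarith
    have : k + 2 * (l * m) = 0 := by exact_mod_cast h'
    obtain ⟨j, rfl⟩ := hk
    lia
  have h₁ : (3 / 2 + m : ℝ) ≠ 0 := by simpa using odd_ne 3 1 (by decide)
  have h₂ : (3 / 2 - m : ℝ) ≠ 0 := by simpa [sub_eq_add_neg] using odd_ne 3 (-1) (by decide)
  have h₃ : (1 / 2 + m : ℝ) ≠ 0 := by simpa using odd_ne 1 1 (by decide)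
  have h₄ : (1 / 2 - m : ℝ) ≠ 0 := by simpa [sub_eq_add_neg] using odd_ne 1 (-1) (by decide)
  have hcos (c : ℝ) (hc : c ≠ 0) (θ : ℝ) :
      HasDerivAt (fun θ => cos (c * θ) / c) (-sin (c * θ)) θ := by
    have h := ((hasDerivAt_id θ).const_mul c).cos.div_const c
    simpa [neg_div, hc] using h
  have hderiv (θ : ℝ) := ((((hcos _ h₁ θ).add (hcos _ h₂ θ)).add (hcos _ h₃ θ)).add
    (hcos _ h₄ θ)).const_mul (-1 / 4)
  have hprod (θ : ℝ) : cos (θ / 2) * cos (m * θ) * sin θ =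
      -1 / 4 * (-sin ((3 / 2 + m) * θ) + -sin ((3 / 2 - m) * θ) + -sin ((1 / 2 + m) * θ) +
        -sin ((1 / 2 - m) * θ)) := by
    rw [show (3 / 2 + m : ℝ) * θ = θ + θ / 2 + m * θ by ring,
      show (3 / 2 - m : ℝ) * θ = θ + θ / 2 - m * θ by ring,
      show (1 / 2 + m : ℝ) * θ = θ - θ / 2 + m * θ by ring,
      show (1 / 2 - m : ℝ) * θ = θ - θ / 2 - m * θ by ring]
    simp only [sin_add, sin_sub, cos_add, cos_sub]
    ring
  simp_rw [hprod]
  rw [intervalIntegral.integral_eq_sub_of_hasDerivAt (fun θ _ => hderiv θ)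
    (Continuous.intervalIntegrable (by fun_prop) _ _)]
  have hzero (c : ℝ) (k : ℤ) (hc : c = (2 * k + 1) / 2) : cos (c * π) = 0 :=
    cos_eq_zero_iff.mpr ⟨k, by rw [hc]; ring⟩
  have e₁ : cos ((3 / 2 + m) * π) = 0 := hzero _ (1 + m) (by push_cast; ring)
  have e₂ : cos ((3 / 2 - m) * π) = 0 := hzero _ (1 - m) (by push_cast; ring)
  have e₃ : cos ((1 / 2 + m) * π) = 0 := hzero _ m (by push_cast; ring)
  have e₄ : cos ((1 / 2 - m) * π) = 0 := hzero _ (-m) (by push_cast; ring)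
  simp only [Pi.add_apply, e₁, e₂, e₃, e₄, mul_zero, cos_zero, zero_div, add_zero, zero_sub]
  rw [show (1 - 4 * (m : ℝ) ^ 2) * (9 - 4 * (m : ℝ) ^ 2) =
    16 * ((1 / 2 + m) * (1 / 2 - m) * ((3 / 2 + m) * (3 / 2 - m))) by ring]
  generalize ha : (3 / 2 + m : ℝ) = a at *
  generalize hb : (3 / 2 - m : ℝ) = b at *
  generalize hc : (1 / 2 + m : ℝ) = c at *
  generalize hd : (1 / 2 - m : ℝ) = d at *
  field_simp
  rw [← ha, ← hb, ← hc, ← hd]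
  ring

/-- The integral of `√(1 + z) * T_m(z)` over `[-1, 1]`. -/
lemma integral_sqrt_one_add_mul_chebyshevT (m : ℕ) :
    ∫ z in (-1 : ℝ)..1, √(1 + z) * (Chebyshev.T ℝ (m : ℤ)).eval z =
      4 * √2 * (3 - 4 * (m : ℝ) ^ 2) / ((1 - 4 * (m : ℝ) ^ 2) * (9 - 4 * (m : ℝ) ^ 2)) := by
  have hsubst := intervalIntegral.integral_comp_mul_deriv (a := π) (b := 0)
    (g := fun z => √(1 + z) * (Chebyshev.T ℝ (m : ℤ)).eval z)
    (fun θ _ => hasDerivAt_cos θ) (by fun_prop) (by fun_prop)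
  rw [cos_pi, cos_zero] at hsubst
  rw [← hsubst, intervalIntegral.integral_symm, ← intervalIntegral.integral_neg]
  calc _ = ∫ θ in (0 : ℝ)..π, √2 * (cos (θ / 2) * cos (m * θ) * sin θ) := by
        refine intervalIntegral.integral_congr fun θ hθ => ?_
        rw [Set.uIcc_of_le pi_pos.le] at hθ
        have hhalf : √(1 + cos θ) = √2 * cos (θ / 2) := by
          rw [cos_half (by linarith [hθ.1, pi_pos]) hθ.2, ← sqrt_mul zero_le_two]
          congr 1
          ring
        simp only [Function.comp_apply, Chebyshev.T_real_cos, hhalf, Int.cast_natCast]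
        ring
    _ = _ := by
        rw [intervalIntegral.integral_const_mul, integral_cos_half_mul_cos_mul_sin]
        ring

/-- The modified Clenshaw–Curtis weights for the square-root endpoint singularity:
`∫_{-1}^{1} √(1+z)·T_m(z) dz = 4√2·(3 - 4m²)/((1 - 4m²)(9 - 4m²))`, and
`∫_{-1}^{1} √(1-z)·T_m(z) dz = (-1)^m · 4√2·(3 - 4m²)/((1 - 4m²)(9 - 4m²))`. -/
theorem integral_sqrt_mul_chebyshevT (m : ℕ) :
    (∫ z in (-1 : ℝ)..1, Real.sqrt (1 + z) * (Polynomial.Chebyshev.T ℝ (m : ℤ)).eval z) =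
        4 * Real.sqrt 2 * (3 - 4 * (m : ℝ) ^ 2) /
          ((1 - 4 * (m : ℝ) ^ 2) * (9 - 4 * (m : ℝ) ^ 2)) ∧
      (∫ z in (-1 : ℝ)..1, Real.sqrt (1 - z) * (Polynomial.Chebyshev.T ℝ (m : ℤ)).eval z) =
        (-1 : ℝ) ^ m * (4 * Real.sqrt 2 * (3 - 4 * (m : ℝ) ^ 2) /
          ((1 - 4 * (m : ℝ) ^ 2) * (9 - 4 * (m : ℝ) ^ 2))) := by
  refine ⟨integral_sqrt_one_add_mul_chebyshevT m, ?_⟩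
  rw [← integral_sqrt_one_add_mul_chebyshevT, ← intervalIntegral.integral_const_mul]
  have hneg := intervalIntegral.integral_comp_neg (a := -1) (b := 1)
    (fun z : ℝ => √(1 - z) * (Chebyshev.T ℝ (m : ℤ)).eval z)
  rw [neg_neg] at hneg
  rw [← hneg]
  refine intervalIntegral.integral_congr fun z _ => ?_
  simp only [sub_neg_eq_add, Chebyshev.T_eval_neg, Int.negOnePow_def, zpow_natCast]
  push_cast
  ring
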